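/- arXiv:1405.2788 — 13 statements merged into one kernel-verified Lean document; each statement's English description precedes it below -/
import Mathlib

section
/- Let R be a local ring with maximal ideal 𝔪, and let A be a 2×2 matrix over R such that the reduction of A modulo 𝔪 is not a scalar matrix in M₂(R/𝔪). Then there exists an invertible matrix P ∈ GL₂(R) such that P⁻¹·A·P equals the companion matrix [[0, −det(A)], [1, tr(A)]]. -/
open Matrix

/-- If `v = (x, y)` is a cyclic vector of `A`, the basis `(v, A v)` brings `A` into companion
form. The hypothesis says that the determinant of `(v, A v)` is a unit. -/
theorem exists_conj_companion_of_isUnit {R : Type*} [CommRing R] (A : Matrix (Fin 2) (Fin 2) R)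
    (x y : R) (h : IsUnit (A 1 0 * x ^ 2 + (A 1 1 - A 0 0) * x * y - A 0 1 * y ^ 2)) :
    ∃ P : GL (Fin 2) R,
      (↑P⁻¹ : Matrix (Fin 2) (Fin 2) R) * A * (↑P : Matrix (Fin 2) (Fin 2) R) =
        !![0, -A.det; 1, A.trace] := by
  let Q : Matrix (Fin 2) (Fin 2) R :=
    !![x, A 0 0 * x + A 0 1 * y; y, A 1 0 * x + A 1 1 * y]
  have hQ : IsUnit Q := by
    rw [isUnit_iff_isUnit_det]
    convert h using 1
    simp only [Q, det_fin_two_of]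
    ring
  obtain ⟨P, hP⟩ := hQ
  refine ⟨P, ?_⟩
  rw [mul_assoc, Units.inv_mul_eq_iff_eq_mul, hP]
  ext i j
  fin_cases i <;> fin_cases j <;>
    simp [Q, mul_apply, Fin.sum_univ_two, det_fin_two, trace_fin_two] <;> ring


/-- Over a local ring `R`, a `2 × 2` matrix whose reduction modulo the maximal ideal is
not scalar is conjugate to the companion matrix `[[0, -det A], [1, tr A]]`. -/
theorem stmt_0 {R : Type*} [CommRing R] [IsLocalRing R]
    (A : Matrix (Fin 2) (Fin 2) R)
    (hA : ¬ ∃ c : IsLocalRing.ResidueField R,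
      A.map (IsLocalRing.residue R) = c • (1 : Matrix (Fin 2) (Fin 2) (IsLocalRing.ResidueField R))) :
    ∃ P : GL (Fin 2) R,
      (↑P⁻¹ : Matrix (Fin 2) (Fin 2) R) * A * (↑P : Matrix (Fin 2) (Fin 2) R) =
        !![0, -A.det; 1, A.trace] := by
  -- One of `(1, 0)`, `(0, 1)`, `(1, 1)` is a cyclic vector.
  by_cases hc : IsUnit (A 1 0)
  · exact exists_conj_companion_of_isUnit A 1 0 (by simpa using hc)
  by_cases hb : IsUnit (A 0 1)
  · exact exists_conj_companion_of_isUnit A 0 1 (by simpa using hb)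
  refine exists_conj_companion_of_isUnit A 1 1 ?_
  by_contra hu
  rw [← IsLocalRing.residue_ne_zero_iff_isUnit, not_not] at hc hb hu
  have hd : IsLocalRing.residue R (A 1 1) = IsLocalRing.residue R (A 0 0) := by
    simpa [hc, hb, sub_eq_zero] using hu
  refine hA ⟨IsLocalRing.residue R (A 0 0), ?_⟩
  ext i j
  fin_cases i <;> fin_cases j <;> simp [hc, hb, hd]
end

section
/- Let R be a local ring with maximal ideal 𝔪, and let A be a 2×2 matrix over R such that the reduction of A modulo 𝔪 is not a scalar matrix in M₂(R/𝔪). If Q is a 2×2 matrix over R satisfying A·Q = Q·A, then there exist λ, μ ∈ R such that Q = λ·I₂ + μ·A. -/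
/-- If one of the entries `A 0 1`, `A 1 0` or `A 0 0 - A 1 1` is a unit, then every matrix
commuting with `A` is a linear combination of `1` and `A`. -/
theorem Matrix.exists_eq_smul_one_add_smul_of_isUnit {R : Type*} [CommRing R]
    {A Q : Matrix (Fin 2) (Fin 2) R} (hQ : A * Q = Q * A)
    (h : IsUnit (A 0 1) ∨ IsUnit (A 1 0) ∨ IsUnit (A 0 0 - A 1 1)) :
    ∃ lam mu : R, Q = lam • (1 : Matrix (Fin 2) (Fin 2) R) + mu • A := by
  have h00 := congrFun₂ hQ 0 0
  have h01 := congrFun₂ hQ 0 1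
  have h10 := congrFun₂ hQ 1 0
  simp only [Matrix.mul_apply, Fin.sum_univ_two] at h00 h01 h10
  suffices H : ∃ mu : R, Q 0 1 = mu * A 0 1 ∧ Q 1 0 = mu * A 1 0 ∧
      Q 0 0 - Q 1 1 = mu * (A 0 0 - A 1 1) by
    obtain ⟨mu, hb, hc, hd⟩ := H
    refine ⟨Q 0 0 - mu * A 0 0, mu, ?_⟩
    ext i j
    fin_cases i <;> fin_cases j <;> simp [hb, hc]
    linear_combination -hd
  rcases h with h | h | h <;> obtain ⟨u, hu⟩ := h.exists_left_inv
  · refine ⟨u * Q 0 1, ?_, ?_, ?_⟩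
    · linear_combination -Q 0 1 * hu
    · linear_combination u * h00 - Q 1 0 * hu
    · linear_combination -u * h01 - (Q 0 0 - Q 1 1) * hu
  · refine ⟨u * Q 1 0, ?_, ?_, ?_⟩
    · linear_combination -u * h00 - Q 0 1 * hu
    · linear_combination -Q 1 0 * hu
    · linear_combination u * h10 - (Q 0 0 - Q 1 1) * hu
  · refine ⟨u * (Q 0 0 - Q 1 1), ?_, ?_, ?_⟩
    · linear_combination u * h01 - Q 0 1 * hu
    · linear_combination -u * h10 - Q 1 0 * hu
    · linear_combination -(Q 0 0 - Q 1 1) * hu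

/-- Over a local ring `R`, if the reduction of a `2 × 2` matrix `A` modulo the maximal ideal
is not scalar, then any matrix commuting with `A` is an `R`-linear combination of `I₂` and `A`. -/
theorem stmt_1 {R : Type*} [CommRing R] [IsLocalRing R]
    (A : Matrix (Fin 2) (Fin 2) R)
    (hA : ¬ ∃ c : IsLocalRing.ResidueField R,
      A.map (IsLocalRing.residue R) = c • (1 : Matrix (Fin 2) (Fin 2) (IsLocalRing.ResidueField R)))
    (Q : Matrix (Fin 2) (Fin 2) R) (hQ : A * Q = Q * A) :
    ∃ lam mu : R, Q = lam • (1 : Matrix (Fin 2) (Fin 2) R) + mu • A := by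
  refine Matrix.exists_eq_smul_one_add_smul_of_isUnit hQ ?_
  by_contra! h
  obtain ⟨hb, hc, hd⟩ := h
  simp only [← IsLocalRing.residue_ne_zero_iff_isUnit, not_not, map_sub, sub_eq_zero] at hb hc hd
  refine hA ⟨IsLocalRing.residue R (A 0 0), ?_⟩
  ext i j
  fin_cases i <;> fin_cases j <;> simp [hb, hc, hd]
end

section
/- Let (R, 𝔪) be an artinian local ring and let I be an ideal of R with 𝔪·I = 0. Let A be a 2×2 matrix over R whose reduction modulo 𝔪 is not a scalar matrix. Then for every 2×2 matrix Y over R all of whose entries lie in I, the following are equivalent: (1) there exists a 2×2 matrix X over R with all entries in I such that A·X − X·A = Y; (2) tr(Y) = 0 and tr(A·Y) = 0. -/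
/-- A `2 × 2` matrix over a local ring with non-scalar reduction has a unit among its
off-diagonal entries and the difference of its diagonal entries. -/
theorem isUnit_entry_of_residue_not_scalar {R : Type*} [CommRing R] [IsLocalRing R]
    (A : Matrix (Fin 2) (Fin 2) R)
    (hA : ¬ ∃ c : IsLocalRing.ResidueField R,
      A.map (IsLocalRing.residue R) =
        c • (1 : Matrix (Fin 2) (Fin 2) (IsLocalRing.ResidueField R))) :
    IsUnit (A 0 1) ∨ IsUnit (A 1 0) ∨ IsUnit (A 0 0 - A 1 1) := by
  by_contra! h
  obtain ⟨hb, hc, he⟩ := h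
  have residue_zero : ∀ x : R, ¬ IsUnit x → IsLocalRing.residue R x = 0 := fun x hx =>
    (IsLocalRing.residue_eq_zero_iff x).2 ((IsLocalRing.mem_maximalIdeal x).2 hx)
  have hd := residue_zero _ he
  rw [map_sub, sub_eq_zero] at hd
  refine hA ⟨IsLocalRing.residue R (A 0 0), ?_⟩
  ext i j
  fin_cases i <;> fin_cases j <;> simp [residue_zero _ hb, residue_zero _ hc, hd]

/-- Let `(R, 𝔪)` be an artinian local ring and `I` an ideal with `𝔪 I = 0`. If `A` is a
`2 × 2` matrix over `R` whose reduction mod `𝔪` is not scalar, then for a matrix `Y` with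
entries in `I`, `Y` lies in the image of `X ↦ A X − X A` (with `X` having entries in `I`)
iff `tr Y = 0` and `tr (A Y) = 0`. -/
theorem stmt_3 {R : Type*} [CommRing R] [IsArtinianRing R] [IsLocalRing R]
    (I : Ideal R) (hI : IsLocalRing.maximalIdeal R * I = ⊥)
    (A : Matrix (Fin 2) (Fin 2) R)
    (hA : ¬ ∃ c : IsLocalRing.ResidueField R,
      A.map (IsLocalRing.residue R) = c • (1 : Matrix (Fin 2) (Fin 2) (IsLocalRing.ResidueField R)))
    (Y : Matrix (Fin 2) (Fin 2) R) (hY : ∀ i j, Y i j ∈ I) :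
    (∃ X : Matrix (Fin 2) (Fin 2) R, (∀ i j, X i j ∈ I) ∧ A * X - X * A = Y) ↔
      Y.trace = 0 ∧ (A * Y).trace = 0 := by
  constructor
  · rintro ⟨X, -, rfl⟩
    simp only [Matrix.trace_fin_two, Matrix.sub_apply, Matrix.mul_apply, Fin.sum_univ_two]
    constructor <;> ring
  · simp only [Matrix.trace_fin_two, Matrix.mul_apply, Fin.sum_univ_two]
    rintro ⟨ht, hAY⟩
    suffices h : ∃ t ∈ I, ∃ y ∈ I, ∃ z ∈ I, A 0 1 * z - A 1 0 * y = Y 0 0 ∧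
        (A 0 0 - A 1 1) * y - A 0 1 * t = Y 0 1 ∧
        A 1 0 * t - (A 0 0 - A 1 1) * z = Y 1 0 by
      obtain ⟨t, ht', y, hy, z, hz, h₁, h₂, h₃⟩ := h
      refine ⟨!![t, y; z, 0], ?_, ?_⟩
      · intro i j
        fin_cases i <;> fin_cases j <;> simp [ht', hy, hz]
      · ext i j
        fin_cases i <;> fin_cases j <;>
          simp only [Fin.zero_eta, Fin.mk_one, Matrix.sub_apply, Matrix.mul_apply,
            Fin.sum_univ_two, Matrix.of_apply, Matrix.cons_val', Matrix.cons_val_zero,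
            Matrix.cons_val_one, Matrix.cons_val_fin_one]
        · linear_combination h₁
        · linear_combination h₂
        · linear_combination h₃
        · linear_combination -h₁ - ht
    obtain hu | hu | hu := isUnit_entry_of_residue_not_scalar A hA <;>
      obtain ⟨v, hv⟩ := hu.exists_right_inv
    · refine ⟨-v * Y 0 1, I.mul_mem_left _ (hY _ _), 0, I.zero_mem, v * Y 0 0,
        I.mul_mem_left _ (hY _ _), ?_, ?_, ?_⟩
      · linear_combination Y 0 0 * hv
      · linear_combination Y 0 1 * hv
      · linear_combination Y 1 0 * hv - v * hAY + v * A 1 1 * ht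
    · refine ⟨v * Y 1 0, I.mul_mem_left _ (hY _ _), -v * Y 0 0, I.mul_mem_left _ (hY _ _),
        0, I.zero_mem, ?_, ?_, ?_⟩
      · linear_combination Y 0 0 * hv
      · linear_combination Y 0 1 * hv - v * hAY + v * A 1 1 * ht
      · linear_combination Y 1 0 * hv
    · refine ⟨0, I.zero_mem, v * Y 0 1, I.mul_mem_left _ (hY _ _), -v * Y 1 0,
        I.mul_mem_left _ (hY _ _), ?_, ?_, ?_⟩
      · linear_combination Y 0 0 * hv - v * hAY + v * A 1 1 * ht
      · linear_combination Y 0 1 * hv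
      · linear_combination Y 1 0 * hv
end

section
/- Let R be a local ring, Γ a monoid, and ρ₁, ρ₂ : Γ → M₂(R) monoid homomorphisms (with ρᵢ(e) = I₂). Assume there exists α ∈ Γ such that m(ρᵢ(α)) := tr(ρᵢ(α))² − 4·det(ρᵢ(α)) is a unit of R for i = 1, 2, and that for every γ ∈ Γ and i = 1, 2 the matrix ρᵢ(γ) lies in the R-submodule R·I₂ + R·ρᵢ(α) of M₂(R). Then there exists P ∈ GL₂(R) with P⁻¹·ρ₁(γ)·P = ρ₂(γ) for all γ ∈ Γ if and only if tr(ρ₁(γ)) = tr(ρ₂(γ)) for all γ ∈ Γ. -/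
open Matrix in
/-- Over a local ring, a `2 × 2` matrix whose characteristic polynomial has unit discriminant is
conjugate to the companion matrix of its characteristic polynomial. -/
theorem exists_mul_eq_mul_companion_of_isUnit_discr {R : Type*} [CommRing R] [IsLocalRing R]
    (X : Matrix (Fin 2) (Fin 2) R) (h : IsUnit (X.trace ^ 2 - 4 * X.det)) :
    ∃ V : GL (Fin 2) R, X * (V : Matrix (Fin 2) (Fin 2) R) =
      (V : Matrix (Fin 2) (Fin 2) R) * !![0, -X.det; 1, X.trace] := by
  obtain ⟨p, q, hpq⟩ : ∃ p q : R,
      IsUnit (p * (X 1 0 * p + X 1 1 * q) - (X 0 0 * p + X 0 1 * q) * q) := by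
    by_cases h10 : IsUnit (X 1 0)
    · exact ⟨1, 0, by simpa using h10⟩
    by_cases h01 : IsUnit (X 0 1)
    · exact ⟨0, 1, by simpa using h01⟩
    refine ⟨1, 1, ?_⟩
    by_contra hs
    rw [← mem_nonunits_iff, ← IsLocalRing.mem_maximalIdeal] at h10 h01 hs
    refine (IsLocalRing.mem_maximalIdeal _).1 ?_ h
    have hdiff : X 1 1 - X 0 0 ∈ IsLocalRing.maximalIdeal R := by
      convert Ideal.add_mem _ (Ideal.sub_mem _ hs h10) h01 using 1
      ring
    convert Ideal.add_mem _ (Ideal.mul_mem_left _ (X 1 1 - X 0 0) hdiff)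
      (Ideal.mul_mem_left _ (4 * X 0 1) h10) using 1
    rw [trace_fin_two, det_fin_two]
    ring
  have hV : IsUnit !![p, X 0 0 * p + X 0 1 * q; q, X 1 0 * p + X 1 1 * q].det := by
    rwa [det_fin_two_of]
  refine ⟨GeneralLinearGroup.mk'' _ hV, ?_⟩
  change X * !![p, X 0 0 * p + X 0 1 * q; q, X 1 0 * p + X 1 1 * q] =
    !![p, X 0 0 * p + X 0 1 * q; q, X 1 0 * p + X 1 1 * q] * _
  ext i j
  fin_cases i <;> fin_cases j <;>
    simp [Matrix.mul_apply, Fin.sum_univ_two, trace_fin_two, det_fin_two] <;> ring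

/-- The trace of the square of a `2 × 2` matrix. -/
theorem Matrix.trace_mul_self_fin_two {R : Type*} [CommRing R] (X : Matrix (Fin 2) (Fin 2) R) :
    (X * X).trace = X.trace ^ 2 - 2 * X.det := by
  simp only [trace_fin_two, det_fin_two, mul_apply, Fin.sum_univ_two]
  ring

/-- The trace of the cube of a `2 × 2` matrix. -/
theorem Matrix.trace_mul_mul_self_fin_two {R : Type*} [CommRing R]
    (X : Matrix (Fin 2) (Fin 2) R) :
    (X * X * X).trace = X.trace ^ 3 - 3 * X.trace * X.det := by
  simp only [trace_fin_two, det_fin_two, mul_apply, Fin.sum_univ_two]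
  ring


/-- Two `2`-dimensional representations with semi-simple mold of a monoid `Γ` over a local
ring `R` are conjugate by some `P ∈ GL₂(R)` iff they have the same trace function. -/
theorem stmt_6 {R : Type*} [CommRing R] [IsLocalRing R] {Γ : Type*} [Monoid Γ]
    (ρ₁ ρ₂ : Γ →* Matrix (Fin 2) (Fin 2) R) (α : Γ)
    (h₁ : IsUnit ((ρ₁ α).trace ^ 2 - 4 * (ρ₁ α).det))
    (h₂ : IsUnit ((ρ₂ α).trace ^ 2 - 4 * (ρ₂ α).det))
    (hmem₁ : ∀ γ : Γ, ∃ a b : R, ρ₁ γ = a • (1 : Matrix (Fin 2) (Fin 2) R) + b • ρ₁ α)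
    (hmem₂ : ∀ γ : Γ, ∃ a b : R, ρ₂ γ = a • (1 : Matrix (Fin 2) (Fin 2) R) + b • ρ₂ α) :
    (∃ P : GL (Fin 2) R, ∀ γ : Γ,
        (↑P⁻¹ : Matrix (Fin 2) (Fin 2) R) * ρ₁ γ * (↑P : Matrix (Fin 2) (Fin 2) R) = ρ₂ γ) ↔
      ∀ γ : Γ, (ρ₁ γ).trace = (ρ₂ γ).trace := by
  constructor
  · rintro ⟨P, hP⟩ γ
    rw [← hP γ, Matrix.trace_units_conj']
  intro htr
  have ht := htr α
  have htr_sq := htr (α * α)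
  have htr_cube := htr (α * α * α)
  simp only [map_mul, Matrix.trace_mul_self_fin_two, Matrix.trace_mul_mul_self_fin_two, ← ht]
    at htr_sq htr_cube
  have hd : (ρ₁ α).det = (ρ₂ α).det := by
    apply h₁.mul_left_cancel
    linear_combination (-(ρ₁ α).trace) * htr_cube + ((ρ₁ α).trace ^ 2 + 2 * (ρ₁ α).det) * htr_sq
  obtain ⟨V, hV⟩ := exists_mul_eq_mul_companion_of_isUnit_discr _ h₁
  obtain ⟨W, hW⟩ := exists_mul_eq_mul_companion_of_isUnit_discr _ h₂
  rw [← ht, ← hd] at hW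
  have hconj : ((V * W⁻¹ : GL (Fin 2) R) : Matrix (Fin 2) (Fin 2) R) * ρ₂ α =
      ρ₁ α * ((V * W⁻¹ : GL (Fin 2) R) : Matrix (Fin 2) (Fin 2) R) := by
    rw [Units.val_mul, ← mul_assoc, hV, ← Units.mul_left_inj W]
    simp only [mul_assoc, hW, Units.inv_mul, mul_one, Units.inv_mul_cancel_left]
  refine ⟨V * W⁻¹, fun γ => ?_⟩
  obtain ⟨a, b, hab⟩ := hmem₁ γ
  obtain ⟨c, d, hcd⟩ := hmem₂ γ
  have h_tr := htr γ
  have h_tr_mul := htr (γ * α)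
  simp only [map_mul, hab, hcd, add_mul, smul_mul_assoc, one_mul, Matrix.trace_add,
    Matrix.trace_smul, Matrix.trace_one, Fintype.card_fin, Nat.cast_ofNat, smul_eq_mul,
    Matrix.trace_mul_self_fin_two, ← ht, ← hd] at h_tr h_tr_mul
  have hac : a = c := by
    apply h₁.mul_left_cancel
    linear_combination ((ρ₁ α).trace ^ 2 - 2 * (ρ₁ α).det) * h_tr - (ρ₁ α).trace * h_tr_mul
  have hbd : b = d := by
    apply h₁.mul_left_cancel
    linear_combination 2 * h_tr_mul - (ρ₁ α).trace * h_tr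
  rw [mul_assoc, Units.inv_mul_eq_iff_eq_mul, hab, hcd, hac, hbd, add_mul, mul_add,
    smul_mul_assoc, smul_mul_assoc, mul_smul_comm, mul_smul_comm, hconj, one_mul, mul_one]
end

section
/- For every natural number n there exists a polynomial f in two variables with integer coefficients, depending only on n, such that for every commutative ring R and every 2×2 matrix A over R, m(Aⁿ) = m(A) · f(tr(A), det(A)), where m(X) := tr(X)² − 4·det(X). -/
theorem Matrix.sq_fin_two_eq {R : Type*} [CommRing R] (A : Matrix (Fin 2) (Fin 2) R) :
    A ^ 2 = A.trace • A - A.det • 1 := by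
  ext i j
  fin_cases i <;> fin_cases j <;>
    simp [sq, Matrix.mul_apply, Matrix.trace_fin_two, Matrix.det_fin_two] <;> ring

theorem Matrix.exists_pow_fin_two_eq (n : ℕ) :
    ∃ p q : MvPolynomial (Fin 2) ℤ,
      ∀ (R : Type*) [CommRing R] (A : Matrix (Fin 2) (Fin 2) R),
        A ^ n = MvPolynomial.aeval ![A.trace, A.det] p • A +
          MvPolynomial.aeval ![A.trace, A.det] q • 1 := by
  induction n with
  | zero => exact ⟨0, 1, fun R _ A => by simp⟩
  | succ n ih =>
    obtain ⟨p, q, h⟩ := ih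
    refine ⟨p * MvPolynomial.X 0 + q, -(p * MvPolynomial.X 1), fun R _ A => ?_⟩
    rw [pow_succ, h, add_mul, smul_mul_assoc, smul_mul_assoc, one_mul, ← sq,
      Matrix.sq_fin_two_eq]
    simp only [map_add, map_mul, map_neg, MvPolynomial.aeval_X, Matrix.cons_val_zero,
      Matrix.cons_val_one]
    module

theorem Matrix.trace_sq_sub_four_mul_det_smul_add_smul_one {R : Type*} [CommRing R]
    (A : Matrix (Fin 2) (Fin 2) R) (a b : R) :
    (a • A + b • 1).trace ^ 2 - 4 * (a • A + b • 1).det =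
      (A.trace ^ 2 - 4 * A.det) * a ^ 2 := by
  simp [Matrix.trace_fin_two, Matrix.det_fin_two]
  ring


/-- For every `n` there is a two-variable integer polynomial `f` such that for every
commutative ring `R` and every `2 × 2` matrix `A` over `R`,
`m(Aⁿ) = m(A) · f(tr A, det A)`, where `m(X) = tr(X)² − 4 det X`. -/
theorem stmt_7 (n : ℕ) :
    ∃ f : MvPolynomial (Fin 2) ℤ,
      ∀ (R : Type) [CommRing R] (A : Matrix (Fin 2) (Fin 2) R),
        (A ^ n).trace ^ 2 - 4 * (A ^ n).det =
          (A.trace ^ 2 - 4 * A.det) * MvPolynomial.aeval ![A.trace, A.det] f := by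
  obtain ⟨p, q, h⟩ := Matrix.exists_pow_fin_two_eq n
  refine ⟨p ^ 2, fun R _ A => ?_⟩
  rw [h, Matrix.trace_sq_sub_four_mul_det_smul_add_smul_one, map_pow]
end

section
/- Let R be a commutative ring in which 2 is invertible, and let Z be a 2×2 matrix over R with tr(Z)² = 4·det(Z). If X and Y are 2×2 matrices over R lying in the R-submodule R·I₂ + R·Z of M₂(R), then 2·tr(X·Y) = tr(X)·tr(Y). -/
/-- Let `2` be invertible in `R` and `Z` a `2 × 2` matrix with `tr(Z)² = 4 det Z`
(so `R·I₂ + R·Z` is a unipotent mold).  Then for `X, Y ∈ R·I₂ + R·Z`,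
`2 tr(X Y) = tr X · tr Y`. -/
theorem stmt_9 {R : Type*} [CommRing R] [Invertible (2 : R)]
    (Z : Matrix (Fin 2) (Fin 2) R) (hZ : Z.trace ^ 2 = 4 * Z.det)
    (X Y : Matrix (Fin 2) (Fin 2) R)
    (hX : ∃ a b : R, X = a • (1 : Matrix (Fin 2) (Fin 2) R) + b • Z)
    (hY : ∃ c d : R, Y = c • (1 : Matrix (Fin 2) (Fin 2) R) + d • Z) :
    2 * (X * Y).trace = X.trace * Y.trace := by
  obtain ⟨a, b, rfl⟩ := hX
  obtain ⟨c, d, rfl⟩ := hY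
  simp only [Matrix.trace_fin_two, Matrix.det_fin_two] at hZ
  simp [Matrix.trace_fin_two, Matrix.mul_apply, Fin.sum_univ_two]
  linear_combination b * d * hZ
end

section
/- Let R be a commutative ring in which 2 is invertible, and let Z be a 2×2 matrix over R with tr(Z)² = 4·det(Z). If X and Y are 2×2 matrices over R lying in the R-submodule R·I₂ + R·Z of M₂(R), then η(X·Y) = (tr(X)/2)·η(Y) + (tr(Y)/2)·η(X), where η(W) := W − (tr(W)/2)·I₂. -/
/-- Let `2` be invertible in `R` and `Z` a `2 × 2` matrix with `tr(Z)² = 4 det Z`.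
For `X, Y ∈ R·I₂ + R·Z`, with `η(W) = W − (tr W / 2)•I₂`:
`η(X Y) = (tr X / 2)•η(Y) + (tr Y / 2)•η(X)`. -/
theorem stmt_10 {R : Type*} [CommRing R] [Invertible (2 : R)]
    (Z : Matrix (Fin 2) (Fin 2) R) (hZ : Z.trace ^ 2 = 4 * Z.det)
    (X Y : Matrix (Fin 2) (Fin 2) R)
    (hX : ∃ a b : R, X = a • (1 : Matrix (Fin 2) (Fin 2) R) + b • Z)
    (hY : ∃ c d : R, Y = c • (1 : Matrix (Fin 2) (Fin 2) R) + d • Z) :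
    X * Y - (⅟2 * (X * Y).trace) • (1 : Matrix (Fin 2) (Fin 2) R) =
      (⅟2 * X.trace) • (Y - (⅟2 * Y.trace) • (1 : Matrix (Fin 2) (Fin 2) R)) +
        (⅟2 * Y.trace) • (X - (⅟2 * X.trace) • (1 : Matrix (Fin 2) (Fin 2) R)) := by
  obtain ⟨a, b, rfl⟩ := hX
  obtain ⟨c, d, rfl⟩ := hY
  have h : (2 : R) * ⅟2 = 1 := mul_invOf_self 2
  ext i j
  fin_cases i <;> fin_cases j <;>
    simp [Matrix.trace_fin_two, Matrix.mul_apply, Fin.sum_univ_two] <;>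
    grind
end

section
/- Let R be a commutative ring in which 2 is invertible, Γ a monoid, r : Γ → R a monoid homomorphism into the multiplicative monoid of R (a character), and a : Γ → R a map satisfying a(γδ) = r(γ)·a(δ) + a(γ)·r(δ) for all γ, δ ∈ Γ (a derivation with respect to r). Let Z be a 2×2 matrix over R with tr(Z)² = 4·det(Z). Then the map ρ : Γ → M₂(R) defined by ρ(γ) := r(γ)·I₂ + a(γ)·η(Z), where η(Z) := Z − (tr(Z)/2)·I₂, is a monoid homomorphism: ρ(e) = I₂ and ρ(γδ) = ρ(γ)·ρ(δ) for all γ, δ ∈ Γ. -/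
/-- The trace-free part of a `2 × 2` matrix with `tr(Z)² = 4 det Z` squares to zero. -/
theorem Matrix.sub_half_trace_smul_one_mul_self {R : Type*} [CommRing R] [Invertible (2 : R)]
    (Z : Matrix (Fin 2) (Fin 2) R) (hZ : Z.trace ^ 2 = 4 * Z.det) :
    (Z - (⅟2 * Z.trace) • (1 : Matrix (Fin 2) (Fin 2) R)) *
      (Z - (⅟2 * Z.trace) • (1 : Matrix (Fin 2) (Fin 2) R)) = 0 := by
  have h2 : (2 : R) * ⅟2 = 1 := mul_invOf_self 2
  generalize (⅟2 : R) = h at h2 ⊢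
  rw [Matrix.trace_fin_two, Matrix.det_fin_two] at hZ
  ext i j
  fin_cases i <;> fin_cases j <;>
    simp [Matrix.mul_apply, Fin.sum_univ_two, Matrix.trace_fin_two]
  · linear_combination h ^ 2 * hZ +
      (-Z 0 0 ^ 2 + 2 * h * (Z 0 0 * Z 1 1) - Z 0 1 * Z 1 0 * (1 + 2 * h)) * h2
  · linear_combination -(Z 0 1 * (Z 0 0 + Z 1 1)) * h2
  · linear_combination -(Z 1 0 * (Z 0 0 + Z 1 1)) * h2
  · linear_combination h ^ 2 * hZ +
      (-Z 1 1 ^ 2 + 2 * h * (Z 0 0 * Z 1 1) - Z 0 1 * Z 1 0 * (1 + 2 * h)) * h2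

/-- Let `2` be invertible in `R`, `r : Γ → R` a character, `a : Γ → R` a derivation with
respect to `r`, and `Z` a `2 × 2` matrix with `tr(Z)² = 4 det Z`.  Then
`ρ(γ) = r(γ)•I₂ + a(γ)•η(Z)` is a monoid homomorphism `Γ → M₂(R)`. -/
theorem stmt_11 {R : Type*} [CommRing R] [Invertible (2 : R)] {Γ : Type*} [Monoid Γ]
    (r : Γ →* R) (a : Γ → R)
    (ha : ∀ γ δ : Γ, a (γ * δ) = r γ * a δ + a γ * r δ)
    (Z : Matrix (Fin 2) (Fin 2) R) (hZ : Z.trace ^ 2 = 4 * Z.det)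
    (ρ : Γ → Matrix (Fin 2) (Fin 2) R)
    (hρ : ∀ γ : Γ, ρ γ = r γ • (1 : Matrix (Fin 2) (Fin 2) R) +
      a γ • (Z - (⅟2 * Z.trace) • (1 : Matrix (Fin 2) (Fin 2) R))) :
    ρ 1 = 1 ∧ ∀ γ δ : Γ, ρ (γ * δ) = ρ γ * ρ δ := by
  have hN := Matrix.sub_half_trace_smul_one_mul_self Z hZ
  generalize Z - (⅟2 * Z.trace) • (1 : Matrix (Fin 2) (Fin 2) R) = N at hN hρ
  have a_one : a 1 = 0 := by simpa using ha 1 1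
  refine ⟨by simp [hρ, a_one], fun γ δ => ?_⟩
  simp only [hρ, ha, map_mul, add_mul, mul_add, smul_mul_smul_comm, hN, mul_one, one_mul,
    smul_zero, add_zero, add_smul, add_assoc]
  rw [add_comm ((r γ * a δ) • N)]
end

section
/- Let R be a commutative ring of characteristic 2, Γ a monoid, d : Γ → R a monoid homomorphism into the multiplicative monoid of R (a character), α ∈ Γ, and Z a 2×2 matrix over R with tr(Z) = 0 and det(Z) = d(α). Let a, b : Γ → R be maps with a(α) = 0, b(α) = 1, and satisfying, for all γ, δ ∈ Γ: a(γδ) = a(γ)·a(δ) + b(γ)·b(δ)·d(α), b(γδ) = a(γ)·b(δ) + b(γ)·a(δ), and a(γ)² + b(γ)²·d(α) = d(γ). Then the map ρ : Γ → M₂(R) defined by ρ(γ) := a(γ)·I₂ + b(γ)·Z is a monoid homomorphism (ρ(e) = I₂ and ρ(γδ) = ρ(γ)·ρ(δ)) and det(ρ(γ)) = d(γ) for every γ ∈ Γ. -/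
/-- Over a commutative ring of characteristic `2`: given a character `d : Γ → R`, `α ∈ Γ`,
a traceless `2 × 2` matrix `Z` with `det Z = d(α)`, and `(a,b)`-coefficients with respect to
`(d, α)`, the map `ρ(γ) = a(γ)•I₂ + b(γ)•Z` is a monoid homomorphism with
`det(ρ(γ)) = d(γ)` for all `γ`. -/
theorem stmt_13 {R : Type*} [CommRing R] (h2 : (2 : R) = 0) {Γ : Type*} [Monoid Γ]
    (d : Γ →* R) (α : Γ)
    (Z : Matrix (Fin 2) (Fin 2) R) (hZtr : Z.trace = 0) (hZdet : Z.det = d α)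
    (a b : Γ → R) (haα : a α = 0) (hbα : b α = 1)
    (hab₁ : ∀ γ δ : Γ, a (γ * δ) = a γ * a δ + b γ * b δ * d α)
    (hab₂ : ∀ γ δ : Γ, b (γ * δ) = a γ * b δ + b γ * a δ)
    (hab₃ : ∀ γ : Γ, a γ ^ 2 + b γ ^ 2 * d α = d γ)
    (ρ : Γ → Matrix (Fin 2) (Fin 2) R)
    (hρ : ∀ γ : Γ, ρ γ = a γ • (1 : Matrix (Fin 2) (Fin 2) R) + b γ • Z) :
    ρ 1 = 1 ∧ (∀ γ δ : Γ, ρ (γ * δ) = ρ γ * ρ δ) ∧ ∀ γ : Γ, (ρ γ).det = d γ := by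
  have ha1 : a 1 = 1 := by
    have h := hab₂ α 1
    rw [mul_one, haα, hbα] at h
    linear_combination -h
  have hb1 : b 1 = 0 := by
    have h := hab₂ 1 1
    rw [mul_one] at h
    linear_combination h + a 1 * b 1 * h2
  rw [Matrix.trace_fin_two] at hZtr
  rw [Matrix.det_fin_two] at hZdet
  refine ⟨by simp [hρ, ha1, hb1], fun γ δ => ?_, fun γ => ?_⟩
  · have hZsq : Z * Z = d α • (1 : Matrix (Fin 2) (Fin 2) R) := by
      ext i j
      fin_cases i <;> fin_cases j <;> simp [Matrix.mul_apply, Fin.sum_univ_two]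
      · linear_combination Z 0 0 * hZtr - hZdet - d α * h2
      · linear_combination Z 0 1 * hZtr
      · linear_combination Z 1 0 * hZtr
      · linear_combination Z 1 1 * hZtr - hZdet - d α * h2
    simp only [hρ, hab₁, hab₂, add_mul, mul_add, smul_mul_assoc, mul_smul_comm, one_mul,
      mul_one, hZsq]
    module
  · rw [hρ, Matrix.det_fin_two]
    simp
    linear_combination a γ * b γ * hZtr + b γ ^ 2 * hZdet + hab₃ γ
end

section
/- Let k be a field and 𝒜 a k-subalgebra of the matrix algebra M₂(k). Then 𝒜 ≠ M₂(k) if and only if 𝒜 is commutative or there exists a one-dimensional k-subspace W of k² that is invariant under 𝒜, i.e. A·w ∈ W (matrix–vector product) for every A ∈ 𝒜 and w ∈ W. -/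
/-- If `𝒜` has no invariant line, then it acts transitively on nonzero vectors of `k²`. -/
theorem exists_mulVec_eq_of_no_invariant_line {k : Type*} [Field k]
    {𝒜 : Subalgebra k (Matrix (Fin 2) (Fin 2) k)}
    (h : ¬ ∃ W : Submodule k (Fin 2 → k), Module.finrank k W = 1 ∧
      ∀ A ∈ 𝒜, ∀ w ∈ W, A.mulVec w ∈ W)
    {v : Fin 2 → k} (hv : v ≠ 0) (u : Fin 2 → k) : ∃ A ∈ 𝒜, A.mulVec v = u := by
  let W : Submodule k (Fin 2 → k) :=
    (Subalgebra.toSubmodule 𝒜).map ((Matrix.mulVecBilin k k).flip v)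
  have mem_W (w : Fin 2 → k) : w ∈ W ↔ ∃ A ∈ 𝒜, A.mulVec v = w := by
    simp [W, Submodule.mem_map]
  have hvW : v ∈ W := (mem_W v).2 ⟨1, one_mem _, Matrix.one_mulVec v⟩
  have hinv : ∀ A ∈ 𝒜, ∀ w ∈ W, A.mulVec w ∈ W := by
    intro A hA w hw
    obtain ⟨B, hB, rfl⟩ := (mem_W w).1 hw
    exact (mem_W _).2 ⟨A * B, mul_mem hA hB, (Matrix.mulVec_mulVec v A B).symm⟩
  have h1 : Module.finrank k W ≠ 1 := fun h1 => h ⟨W, h1, hinv⟩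
  have h0 : Module.finrank k W ≠ 0 := fun h0 => by
    rw [Submodule.finrank_eq_zero.1 h0, Submodule.mem_bot] at hvW
    exact hv hvW
  have hle : Module.finrank k W ≤ Module.finrank k (Fin 2 → k) := Submodule.finrank_le W
  have htop : W = ⊤ := by
    apply Submodule.eq_top_of_finrank_eq
    rw [Module.finrank_fin_fun] at hle ⊢
    omega
  exact (mem_W u).1 (htop ▸ Submodule.mem_top)

/-- If `𝒜` moves `e₀` to `e₁` and no nonzero element of `𝒜` kills `e₀`, then `𝒜` is
commutative. -/
theorem commute_of_forall_eq_zero_of_mulVec_eq_zero {k : Type*} [Field k]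
    {𝒜 : Subalgebra k (Matrix (Fin 2) (Fin 2) k)}
    {Z : Matrix (Fin 2) (Fin 2) k} (hZ : Z ∈ 𝒜) (hZe : Z.mulVec ![1, 0] = ![0, 1])
    (hinj : ∀ B ∈ 𝒜, B.mulVec ![1, 0] = 0 → B = 0) :
    ∀ X ∈ 𝒜, ∀ Y ∈ 𝒜, X * Y = Y * X := by
  have key : ∀ X ∈ 𝒜, X = X 0 0 • 1 + X 1 0 • Z := by
    intro X hX
    refine sub_eq_zero.1 (hinj _ (sub_mem hX (add_mem (𝒜.smul_mem (one_mem _) _)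
      (𝒜.smul_mem hZ _))) ?_)
    rw [Matrix.sub_mulVec, Matrix.add_mulVec, Matrix.smul_mulVec, Matrix.smul_mulVec, hZe]
    ext i
    fin_cases i <;> simp
  intro X hX Y hY
  rw [key X hX, key Y hY]
  simp only [add_mul, mul_add, smul_mul_assoc, mul_smul_comm, one_mul, mul_one]
  module

/-- An algebra `𝒜` of `2 × 2` matrices over a field without invariant lines is either commutative
or everything. -/
theorem eq_top_of_no_invariant_line {k : Type*} [Field k]
    {𝒜 : Subalgebra k (Matrix (Fin 2) (Fin 2) k)}
    (h : ¬ ∃ W : Submodule k (Fin 2 → k), Module.finrank k W = 1 ∧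
      ∀ A ∈ 𝒜, ∀ w ∈ W, A.mulVec w ∈ W)
    (hcomm : ¬ ∀ X ∈ 𝒜, ∀ Y ∈ 𝒜, X * Y = Y * X) : 𝒜 = ⊤ := by
  obtain ⟨Z, hZ, hZe⟩ := exists_mulVec_eq_of_no_invariant_line h
    (v := ![1, 0]) (by simp) ![0, 1]
  obtain ⟨B, hB, hBe, hB0⟩ : ∃ B ∈ 𝒜, B.mulVec ![1, 0] = 0 ∧ B ≠ 0 := by
    by_contra! hinj
    exact hcomm (commute_of_forall_eq_zero_of_mulVec_eq_zero hZ hZe hinj)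
  have hB00 : B 0 0 = 0 := by simpa [Matrix.mulVec, dotProduct] using congrFun hBe 0
  have hB10 : B 1 0 = 0 := by simpa [Matrix.mulVec, dotProduct] using congrFun hBe 1
  have hZ00 : Z 0 0 = 0 := by simpa [Matrix.mulVec, dotProduct] using congrFun hZe 0
  have hZ10 : Z 1 0 = 1 := by simpa [Matrix.mulVec, dotProduct] using congrFun hZe 1
  have hu : B.col 1 ≠ 0 := fun hu => hB0 <| by
    have h0 := congrFun hu 0
    have h1 := congrFun hu 1
    ext i j
    fin_cases i <;> fin_cases j <;> simp_all
  -- Every matrix with vanishing first column lies in `𝒜`.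
  have hcol (u : Fin 2 → k) : !![0, u 0; 0, u 1] ∈ 𝒜 := by
    obtain ⟨C, hC, hCu⟩ := exists_mulVec_eq_of_no_invariant_line h hu u
    have hCB : C * B = !![0, u 0; 0, u 1] := by
      rw [← hCu]
      ext i j
      fin_cases i <;> fin_cases j <;>
        simp [Matrix.mul_apply, Matrix.mulVec, dotProduct, hB00, hB10]
    exact hCB ▸ mul_mem hC hB
  refine Algebra.eq_top_iff.2 fun M => ?_
  have hM : M = !![0, M 0 0; 0, M 1 0] * Z +
      !![0, ![M 0 1 - M 0 0 * Z 1 1, M 1 1 - M 1 0 * Z 1 1] 0;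
        0, ![M 0 1 - M 0 0 * Z 1 1, M 1 1 - M 1 0 * Z 1 1] 1] := by
    ext i j
    fin_cases i <;> fin_cases j <;> simp [Matrix.vecMul, dotProduct, hZ10]
  rw [hM]
  exact add_mem (mul_mem (hcol (M.col 0)) hZ) (hcol _)

/-- A nonzero subspace of `kⁿ` that is invariant under all matrices is everything. -/
theorem eq_top_of_forall_mulVec_mem {k n : Type*} [Field k] [Fintype n] [DecidableEq n]
    {W : Submodule k (n → k)} (hW : W ≠ ⊥)
    (hinv : ∀ A : Matrix n n k, ∀ w ∈ W, A.mulVec w ∈ W) : W = ⊤ := by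
  obtain ⟨v, hvW, hv⟩ := W.exists_mem_ne_zero_of_ne_bot hW
  obtain ⟨j, hj⟩ := Function.ne_iff.1 hv
  refine Submodule.eq_top_iff'.2 fun u => ?_
  have hu : (Matrix.vecMulVec u (Pi.single j (v j)⁻¹)).mulVec v = u := by
    rw [Matrix.vecMulVec_mulVec, single_dotProduct, inv_mul_cancel₀ hj]
    simp
  exact hu ▸ hinv _ v hvW

/-- A `k`-subalgebra `𝒜` of `M₂(k)` is proper iff `𝒜` is commutative or there is a
one-dimensional `𝒜`-invariant subspace of `k²`. -/
theorem stmt_14 {k : Type*} [Field k] (𝒜 : Subalgebra k (Matrix (Fin 2) (Fin 2) k)) :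
    𝒜 ≠ ⊤ ↔
      (∀ X ∈ 𝒜, ∀ Y ∈ 𝒜, X * Y = Y * X) ∨
        ∃ W : Submodule k (Fin 2 → k), Module.finrank k W = 1 ∧
          ∀ A ∈ 𝒜, ∀ w ∈ W, A.mulVec w ∈ W := by
  constructor
  · intro hne
    by_contra! hcon
    exact hne (eq_top_of_no_invariant_line (by push Not; exact hcon.2) (by push Not; exact hcon.1))
  · rintro (hcomm | ⟨W, hW, hinv⟩) rfl
    · have h := hcomm !![0, 1; 0, 0] Algebra.mem_top !![0, 0; 1, 0] Algebra.mem_top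
      simpa using congrFun (congrFun h 0) 0
    · have hbot : W ≠ ⊥ := by
        rintro rfl
        simp at hW
      rw [eq_top_of_forall_mulVec_mem hbot fun A => hinv A Algebra.mem_top, finrank_top,
        Module.finrank_fin_fun] at hW
      omega
end

section
/- Let k be a field and A, B ∈ M₂(k), and let 𝒜 be the k-subalgebra of M₂(k) generated by A and B. Then the following are equivalent: (1) Δ(A,B) = 0; (2) 𝒜 ≠ M₂(k); (3) A·B = B·A, or there exists a one-dimensional k-subspace W of k² invariant under both A and B (that is, A·w ∈ W and B·w ∈ W for every w ∈ W). -/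
/-- The discriminant `Δ(A,B)` of a pair of `2 × 2` matrices. -/
def matrixDisc {R : Type*} [CommRing R] (A B : Matrix (Fin 2) (Fin 2) R) : R :=
  A.trace ^ 2 * B.det + B.trace ^ 2 * A.det + (A * B).trace ^ 2 -
    A.trace * B.trace * (A * B).trace - 4 * A.det * B.det

theorem matrixDisc_eq_neg_det_commutator {R : Type*} [CommRing R]
    (A B : Matrix (Fin 2) (Fin 2) R) : matrixDisc A B = -(A * B - B * A).det := by
  simp only [matrixDisc, Matrix.trace_fin_two, Matrix.det_fin_two, Matrix.mul_apply,
    Matrix.sub_apply, Fin.sum_univ_two]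
  ring

/-- Every matrix, scaled by `Δ(A,B)`, is a combination of `1, A, B, AB`; the coefficients come from
the dual basis for the trace form, which consists (up to the coefficient of `1`) of commutators. -/
theorem exists_matrixDisc_smul_eq {R : Type*} [CommRing R] (A B X : Matrix (Fin 2) (Fin 2) R) :
    ∃ r : R, matrixDisc A B • X = r • (1 : Matrix (Fin 2) (Fin 2) R) +
      (X * (B * (A * B) - A * B * B)).trace • A + (X * (A * B * A - A * (A * B))).trace • B +
      (X * (A * B - B * A)).trace • (A * B) := by
  refine ⟨(matrixDisc A B • X - (X * (B * (A * B) - A * B * B)).trace • A -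
    (X * (A * B * A - A * (A * B))).trace • B - (X * (A * B - B * A)).trace • (A * B)) 0 0, ?_⟩
  ext i j
  fin_cases i <;> fin_cases j <;>
  · simp [matrixDisc, Matrix.trace_fin_two, Matrix.det_fin_two, Matrix.mul_apply,
      Fin.sum_univ_two]
    ring

theorem adjoin_pair_eq_top_of_matrixDisc_ne_zero {k : Type*} [Field k]
    {A B : Matrix (Fin 2) (Fin 2) k} (h : matrixDisc A B ≠ 0) :
    Algebra.adjoin k {A, B} = (⊤ : Subalgebra k (Matrix (Fin 2) (Fin 2) k)) := by
  refine (Algebra.eq_top_iff).2 fun X => ?_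
  have hA : A ∈ Algebra.adjoin k {A, B} := Algebra.subset_adjoin (by simp)
  have hB : B ∈ Algebra.adjoin k {A, B} := Algebra.subset_adjoin (by simp)
  obtain ⟨r, hr⟩ := exists_matrixDisc_smul_eq A B X
  rw [← inv_smul_smul₀ h X, hr]
  exact Subalgebra.smul_mem _ (add_mem (add_mem (add_mem (Subalgebra.smul_mem _ (one_mem _) _)
    (Subalgebra.smul_mem _ hA _)) (Subalgebra.smul_mem _ hB _))
    (Subalgebra.smul_mem _ (mul_mem hA hB) _)) _

/-- A commutator `C = AB - BA` anticommutes with `A` up to a multiple of `C`. -/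
theorem commutator_mul_left {R : Type*} [CommRing R] (A B : Matrix (Fin 2) (Fin 2) R) :
    (A * B - B * A) * A = (A.trace • 1 - A) * (A * B - B * A) := by
  ext i j
  fin_cases i <;> fin_cases j <;>
  · simp [Matrix.trace_fin_two, Matrix.mul_apply, Fin.sum_univ_two]
    ring

theorem mulVec_mem_ker_commutator {R : Type*} [CommRing R] (A B : Matrix (Fin 2) (Fin 2) R)
    {w : Fin 2 → R} (hw : w ∈ LinearMap.ker (A * B - B * A).mulVecLin) :
    A.mulVec w ∈ LinearMap.ker (A * B - B * A).mulVecLin := by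
  rw [LinearMap.mem_ker, Matrix.mulVecLin_apply] at hw ⊢
  rw [Matrix.mulVec_mulVec, commutator_mul_left, ← Matrix.mulVec_mulVec, hw, Matrix.mulVec_zero]

theorem ker_commutator_swap {R : Type*} [CommRing R] (A B : Matrix (Fin 2) (Fin 2) R) :
    LinearMap.ker (B * A - A * B).mulVecLin = LinearMap.ker (A * B - B * A).mulVecLin := by
  ext w
  simp only [LinearMap.mem_ker, Matrix.mulVecLin_apply]
  rw [← neg_sub, Matrix.neg_mulVec, neg_eq_zero]

theorem finrank_ker_mulVecLin_eq_one {k : Type*} [Field k] {C : Matrix (Fin 2) (Fin 2) k}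
    (h0 : C ≠ 0) (hdet : C.det = 0) : Module.finrank k (LinearMap.ker C.mulVecLin) = 1 := by
  have hpos : LinearMap.ker C.mulVecLin ≠ ⊥ := by
    obtain ⟨v, hv, hCv⟩ := Matrix.exists_mulVec_eq_zero_iff.2 hdet
    exact (Submodule.ne_bot_iff _).2 ⟨v, by simpa using hCv, hv⟩
  have hlt : LinearMap.ker C.mulVecLin ≠ ⊤ := by
    rw [Ne, LinearMap.ker_eq_top, ← Matrix.toLin'_apply']
    simpa using h0
  have h1 := Submodule.finrank_lt hlt
  have h2 := Submodule.one_le_finrank_iff.2 hpos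
  simp at h1
  omega

theorem adjoin_pair_ne_top_of_commute {k : Type*} [Field k] {A B : Matrix (Fin 2) (Fin 2) k}
    (h : A * B = B * A) :
    Algebra.adjoin k {A, B} ≠ (⊤ : Subalgebra k (Matrix (Fin 2) (Fin 2) k)) := by
  intro htop
  have hc : ∀ X Y : Matrix (Fin 2) (Fin 2) k, X * Y = Y * X := fun X Y =>
    Algebra.commute_of_mem_adjoin_of_forall_mem_commute (R := k) (s := {A, B})
      (htop ▸ Algebra.mem_top) fun Z hZ =>
        (Algebra.commute_of_mem_adjoin_of_forall_mem_commute (R := k) (s := {A, B})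
          (htop ▸ Algebra.mem_top) fun V hV => by
            rcases hZ with rfl | rfl <;> rcases hV with rfl | rfl <;>
              first | exact Commute.refl _ | exact h | exact h.symm).symm
  simpa [Matrix.mul_apply, Fin.sum_univ_two] using
    congrFun (congrFun (hc !![0, 1; 0, 0] !![0, 0; 1, 0]) 0) 0

theorem adjoin_ne_top_of_invariant {k : Type*} [Field k] {s : Set (Matrix (Fin 2) (Fin 2) k)}
    {W : Submodule k (Fin 2 → k)} (hW : Module.finrank k W = 1)
    (hs : ∀ X ∈ s, ∀ w ∈ W, X.mulVec w ∈ W) :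
    Algebra.adjoin k s ≠ (⊤ : Subalgebra k (Matrix (Fin 2) (Fin 2) k)) := by
  intro htop
  have hall : ∀ X : Matrix (Fin 2) (Fin 2) k, ∀ w ∈ W, X.mulVec w ∈ W := by
    intro X
    have hX : X ∈ Algebra.adjoin k s := htop ▸ Algebra.mem_top
    induction hX using Algebra.adjoin_induction with
    | mem X hX => exact hs X hX
    | algebraMap r =>
      intro w hw
      rw [Algebra.algebraMap_eq_smul_one, Matrix.smul_mulVec, Matrix.one_mulVec]
      exact W.smul_mem r hw
    | add X Y _ _ hX hY =>
      intro w hw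
      rw [Matrix.add_mulVec]
      exact W.add_mem (hX w hw) (hY w hw)
    | mul X Y _ _ hX hY =>
      intro w hw
      rw [← Matrix.mulVec_mulVec]
      exact hX _ (hY w hw)
  have hbot : W ≠ ⊥ := by
    rintro rfl
    simp at hW
  obtain ⟨w, hw, hw0⟩ := (Submodule.ne_bot_iff _).1 hbot
  obtain ⟨i, hi⟩ := Function.ne_iff.1 hw0
  have htopW : W = ⊤ := by
    refine eq_top_iff.2 fun v _ => ?_
    have hv := hall (Matrix.vecMulVec v (Pi.single i (w i)⁻¹)) w hw
    rwa [Matrix.vecMulVec_mulVec, single_dotProduct, inv_mul_cancel₀ hi, MulOpposite.op_one,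
      one_smul] at hv
  rw [htopW, finrank_top] at hW
  simp at hW

/-- For `A, B ∈ M₂(k)`, the following are equivalent: `Δ(A,B) = 0`; the subalgebra
generated by `A` and `B` is proper; `A` and `B` commute or have a common one-dimensional
invariant subspace. -/
theorem stmt_15 {k : Type*} [Field k] (A B : Matrix (Fin 2) (Fin 2) k) :
    [matrixDisc A B = 0,
      Algebra.adjoin k {A, B} ≠ (⊤ : Subalgebra k (Matrix (Fin 2) (Fin 2) k)),
      A * B = B * A ∨
        ∃ W : Submodule k (Fin 2 → k), Module.finrank k W = 1 ∧
          (∀ w ∈ W, A.mulVec w ∈ W) ∧ (∀ w ∈ W, B.mulVec w ∈ W)].TFAE := by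
  tfae_have 1 → 3 := by
    intro h
    rw [matrixDisc_eq_neg_det_commutator, neg_eq_zero] at h
    refine or_iff_not_imp_left.2 fun hne => ⟨LinearMap.ker (A * B - B * A).mulVecLin,
      finrank_ker_mulVecLin_eq_one (sub_ne_zero.2 hne) h,
      fun w hw => mulVec_mem_ker_commutator A B hw, fun w hw => ?_⟩
    rw [← ker_commutator_swap] at hw ⊢
    exact mulVec_mem_ker_commutator B A hw
  tfae_have 3 → 2 := by
    rintro (h | ⟨W, hW, hA, hB⟩)
    · exact adjoin_pair_ne_top_of_commute h
    · refine adjoin_ne_top_of_invariant hW ?_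
      rintro X (rfl | rfl)
      exacts [hA, hB]
  tfae_have 2 → 1 := by
    intro h
    by_contra hne
    exact h (adjoin_pair_eq_top_of_matrixDisc_ne_zero hne)
  tfae_finish
end

section
/- Let k be a field, A, B, C ∈ M₂(k), and let 𝒜 be the k-subalgebra of M₂(k) generated by A, B, and C. Then 𝒜 ≠ M₂(k) if and only if Δ(A,B) = 0, Δ(B,C) = 0, Δ(C,A) = 0, and τ(A,B,C) = 0. -/
/-- The invariant `τ(A,B,C) = tr(ABC) − tr(ACB)` of a triple of `2 × 2` matrices. -/
def matrixTau {R : Type*} [CommRing R] (A B C : Matrix (Fin 2) (Fin 2) R) : R :=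
  (A * B * C).trace - (A * C * B).trace

/-- Cramer's rule: if `τ(X,Y,Z)` is invertible, then `X, Y, Z, 1` span `M₂(R)`. -/
theorem matrixTau_smul_eq {R : Type*} [CommRing R] (X Y Z M : Matrix (Fin 2) (Fin 2) R) :
    ∃ c : R, matrixTau X Y Z • M =
      matrixTau M Y Z • X + matrixTau X M Z • Y + matrixTau X Y M • Z + c • 1 := by
  refine ⟨matrixTau X Y Z * M 0 0 - matrixTau M Y Z * X 0 0 - matrixTau X M Z * Y 0 0 -
    matrixTau X Y M * Z 0 0, ?_⟩
  ext i j
  fin_cases i <;> fin_cases j <;>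
    simp [matrixTau, Matrix.mul_apply, Matrix.trace_fin_two, Fin.sum_univ_two] <;> ring

/-- A subalgebra of `M₂(k)` containing a triple with nonzero `τ` is everything. -/
theorem Subalgebra.eq_top_of_matrixTau_ne_zero {k : Type*} [Field k]
    {S : Subalgebra k (Matrix (Fin 2) (Fin 2) k)} {X Y Z : Matrix (Fin 2) (Fin 2) k}
    (hX : X ∈ S) (hY : Y ∈ S) (hZ : Z ∈ S) (h : matrixTau X Y Z ≠ 0) : S = ⊤ := by
  refine eq_top_iff.2 fun M _ => ?_
  obtain ⟨c, hc⟩ := matrixTau_smul_eq X Y Z M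
  rw [← inv_smul_smul₀ h M, hc]
  exact S.smul_mem (S.add_mem (S.add_mem (S.add_mem (S.smul_mem hX _) (S.smul_mem hY _))
    (S.smul_mem hZ _)) (S.smul_mem S.one_mem _)) _

theorem matrixTau_mul_eq_matrixDisc {R : Type*} [CommRing R] (A B : Matrix (Fin 2) (Fin 2) R) :
    matrixTau A B (A * B) = matrixDisc A B := by
  simp [matrixTau, matrixDisc, Matrix.mul_apply, Matrix.trace_fin_two, Matrix.det_fin_two,
    Fin.sum_univ_two]
  ring

theorem det_commutator_eq_neg_matrixDisc {R : Type*} [CommRing R]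
    (A B : Matrix (Fin 2) (Fin 2) R) : (A * B - B * A).det = -matrixDisc A B := by
  simp [matrixDisc, Matrix.mul_apply, Matrix.trace_fin_two, Matrix.det_fin_two,
    Fin.sum_univ_two]
  ring

/-- If `N` is a nonzero nilpotent `2 × 2` matrix and `tr(MN) = 0`, then `M` preserves the image
line of `N`. -/
theorem exists_mul_eq_smul_of_trace_mul_eq_zero {k : Type*} [Field k]
    {N M : Matrix (Fin 2) (Fin 2) k} (hN : N ≠ 0) (htr : N.trace = 0) (hdet : N.det = 0)
    (h : (M * N).trace = 0) : ∃ c : k, M * N = c • N := by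
  rw [Matrix.trace_fin_two] at htr
  rw [Matrix.det_fin_two] at hdet
  simp only [Matrix.trace_fin_two, Matrix.mul_apply, Fin.sum_univ_two] at h
  by_cases hq : N 0 1 = 0
  · have hp : N 0 0 = 0 := by grind
    have hs : N 1 1 = 0 := by grind
    have hr : N 1 0 ≠ 0 := by
      intro hr
      apply hN
      ext i j
      fin_cases i <;> fin_cases j <;> simpa
    refine ⟨M 1 1, ?_⟩
    ext i j
    fin_cases i <;> fin_cases j <;>
      simp [Matrix.mul_apply, Fin.sum_univ_two] <;> grind
  · refine ⟨(M 0 0 * N 0 1 + M 0 1 * N 1 1) / N 0 1, ?_⟩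
    ext i j
    fin_cases i <;> fin_cases j <;>
      simp [Matrix.mul_apply, Fin.sum_univ_two] <;> grind

/-- Matrices which all preserve the image line of a nonzero nilpotent matrix `N` generate a proper
subalgebra. -/
theorem adjoin_ne_top_of_forall_trace_mul_eq_zero {k : Type*} [Field k]
    {s : Set (Matrix (Fin 2) (Fin 2) k)} {N : Matrix (Fin 2) (Fin 2) k} (hN : N ≠ 0)
    (htr : N.trace = 0) (hdet : N.det = 0) (h : ∀ M ∈ s, (M * N).trace = 0) :
    Algebra.adjoin k s ≠ ⊤ := by
  intro htop
  have key : ∀ M ∈ Algebra.adjoin k s, ∃ c : k, M * N = c • N := by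
    intro M hM
    induction hM using Algebra.adjoin_induction with
    | mem M hM => exact exists_mul_eq_smul_of_trace_mul_eq_zero hN htr hdet (h M hM)
    | algebraMap r => exact ⟨r, (Algebra.smul_def r N).symm⟩
    | add X Y _ _ hX hY =>
      obtain ⟨a, ha⟩ := hX
      obtain ⟨b, hb⟩ := hY
      exact ⟨a + b, by rw [add_mul, ha, hb, add_smul]⟩
    | mul X Y _ _ hX hY =>
      obtain ⟨a, ha⟩ := hX
      obtain ⟨b, hb⟩ := hY
      exact ⟨b * a, by rw [mul_assoc, hb, mul_smul_comm, ha, smul_smul]⟩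
  refine hN (Matrix.ext_iff_trace_mul_left.2 fun M => ?_)
  obtain ⟨c, hc⟩ := key M (htop ▸ Algebra.mem_top)
  simp [hc, htr]

theorem adjoin_ne_top_of_pairwise_commute {k : Type*} [Field k]
    {s : Set (Matrix (Fin 2) (Fin 2) k)} (h : ∀ X ∈ s, ∀ Y ∈ s, X * Y = Y * X) :
    Algebra.adjoin k s ≠ ⊤ := by
  intro htop
  have := Algebra.isMulCommutative_adjoin k h
  have hcomm (X Y : Matrix (Fin 2) (Fin 2) k) : X * Y = Y * X :=
    setLike_mul_comm (s := Algebra.adjoin k s) (htop ▸ Algebra.mem_top)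
      (htop ▸ Algebra.mem_top)
  simpa [Matrix.mul_apply, Fin.sum_univ_two] using
    congrFun (congrFun (hcomm !![0, 1; 0, 0] !![0, 0; 1, 0]) 0) 0

/-- Two non-commuting matrices with `Δ(A,B) = 0`, together with any `C` with `τ(C,A,B) = 0`,
generate a proper subalgebra. -/
theorem adjoin_ne_top_of_not_commute {k : Type*} [Field k] {A B C : Matrix (Fin 2) (Fin 2) k}
    (hAB : A * B ≠ B * A) (hd : matrixDisc A B = 0) (ht : matrixTau C A B = 0) :
    Algebra.adjoin k {A, B, C} ≠ ⊤ := by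
  refine adjoin_ne_top_of_forall_trace_mul_eq_zero (N := A * B - B * A) (sub_ne_zero.2 hAB)
    (by rw [Matrix.trace_sub, Matrix.trace_mul_comm, sub_self])
    (by rw [det_commutator_eq_neg_matrixDisc, hd, neg_zero]) ?_
  rintro M (rfl | rfl | rfl)
  · rw [mul_sub, Matrix.trace_sub, Matrix.trace_mul_comm, mul_assoc, ← mul_assoc, sub_self]
  · rw [mul_sub, Matrix.trace_sub, ← mul_assoc, Matrix.trace_mul_comm, sub_self]
  · rw [mul_sub, Matrix.trace_sub, ← mul_assoc, ← mul_assoc]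
    exact ht

theorem matrixTau_rotate {R : Type*} [CommRing R] (A B C : Matrix (Fin 2) (Fin 2) R) :
    matrixTau B C A = matrixTau A B C := by
  rw [matrixTau, matrixTau, Matrix.trace_mul_comm, Matrix.trace_mul_comm (B * A),
    ← mul_assoc, ← mul_assoc, Matrix.trace_mul_comm (C * B), ← mul_assoc]

/-- For `A, B, C ∈ M₂(k)`, the subalgebra they generate is proper iff
`Δ(A,B) = Δ(B,C) = Δ(C,A) = 0` and `τ(A,B,C) = 0`. -/
theorem stmt_17 {k : Type*} [Field k] (A B C : Matrix (Fin 2) (Fin 2) k) :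
    Algebra.adjoin k {A, B, C} ≠ (⊤ : Subalgebra k (Matrix (Fin 2) (Fin 2) k)) ↔
      matrixDisc A B = 0 ∧ matrixDisc B C = 0 ∧ matrixDisc C A = 0 ∧
        matrixTau A B C = 0 := by
  constructor
  · intro h
    have hA : A ∈ Algebra.adjoin k {A, B, C} := Algebra.subset_adjoin (by simp)
    have hB : B ∈ Algebra.adjoin k {A, B, C} := Algebra.subset_adjoin (by simp)
    have hC : C ∈ Algebra.adjoin k {A, B, C} := Algebra.subset_adjoin (by simp)
    have tau_eq_zero {X Y Z : Matrix (Fin 2) (Fin 2) k} (hX : X ∈ Algebra.adjoin k {A, B, C})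
        (hY : Y ∈ Algebra.adjoin k {A, B, C}) (hZ : Z ∈ Algebra.adjoin k {A, B, C}) :
        matrixTau X Y Z = 0 :=
      by_contra fun h0 => h (Subalgebra.eq_top_of_matrixTau_ne_zero hX hY hZ h0)
    simp only [← matrixTau_mul_eq_matrixDisc]
    exact ⟨tau_eq_zero hA hB (mul_mem hA hB), tau_eq_zero hB hC (mul_mem hB hC),
      tau_eq_zero hC hA (mul_mem hC hA), tau_eq_zero hA hB hC⟩
  · rintro ⟨hAB, hBC, hCA, ht⟩
    by_cases cAB : A * B = B * A
    · by_cases cBC : B * C = C * B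
      · by_cases cCA : C * A = A * C
        · refine adjoin_ne_top_of_pairwise_commute ?_
          rintro X (rfl | rfl | rfl) Y (rfl | rfl | rfl) <;>
            first | rfl | assumption | (symm; assumption)
        · rw [show ({A, B, C} : Set (Matrix (Fin 2) (Fin 2) k)) = {C, A, B} by
            ext; simp; tauto]
          exact adjoin_ne_top_of_not_commute cCA hCA (by rwa [matrixTau_rotate])
      · rw [show ({A, B, C} : Set (Matrix (Fin 2) (Fin 2) k)) = {B, C, A} by
          ext; simp; tauto]
        exact adjoin_ne_top_of_not_commute cBC hBC ht
    · exact adjoin_ne_top_of_not_commute cAB hAB (by rwa [← matrixTau_rotate])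
end

section
/- Let R be a commutative ring and A, B ∈ GL₂(R) invertible 2×2 matrices over R. Then Δ(A,B) = det(A)·det(B)·tr(A·B·A⁻¹·B⁻¹ − I₂). -/
/-- For invertible `2 × 2` matrices `A`, `B` over a commutative ring `R`:
`Δ(A,B) = det A · det B · tr(A B A⁻¹ B⁻¹ − I₂)`. -/
theorem stmt_19 {R : Type*} [CommRing R] (A B : Matrix (Fin 2) (Fin 2) R)
    (hA : IsUnit A.det) (hB : IsUnit B.det) :
    matrixDisc A B =
      A.det * B.det * (A * B * A⁻¹ * B⁻¹ - 1).trace := by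
  have hadj {M : Matrix (Fin 2) (Fin 2) R} (hM : IsUnit M.det) :
      M.det • M⁻¹ = M.adjugate := by
    rw [Matrix.inv_def, smul_smul, Ring.mul_inverse_cancel _ hM, one_smul]
  have hcomm : A.det * B.det * (A * B * A⁻¹ * B⁻¹).trace =
      (A * B * A.adjugate * B.adjugate).trace := by
    rw [← hadj hA, ← hadj hB]
    simp only [Matrix.mul_smul, Matrix.smul_mul, Matrix.trace_smul, smul_eq_mul]
    ring
  rw [Matrix.trace_sub, mul_sub, hcomm, matrixDisc]
  simp [Matrix.trace_fin_two, Matrix.det_fin_two, Matrix.adjugate_fin_two, Matrix.mul_apply]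
  ring
end
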